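/- arXiv:2508.09002 — 2 statements merged into one kernel-verified Lean document; each statement's English description precedes it below -/
import Mathlib

section
/- Let H be a complex Hilbert space and let T : H → H be a compact self-adjoint bounded linear operator such that ⟨f, f + Tf⟩ > 0 for every f ≠ 0 in H (this inner product is automatically real). Then there exists λ > 0 such that ⟨f, f + Tf⟩ ≥ λ‖f‖² for all f ∈ H, and moreover ‖f + Tf‖ ≥ λ‖f‖ for all f ∈ H. -/
open scoped InnerProductSpace

/-- A strictly positive operator on a complex Hilbert space is coercive. -/
theorem IsStrictlyPositive.exists_pos_mul_norm_sq_le_re_inner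
    {H : Type*} [NormedAddCommGroup H] [InnerProductSpace ℂ H] [CompleteSpace H]
    {S : H →L[ℂ] H} (hS : IsStrictlyPositive S) :
    ∃ c : ℝ, 0 < c ∧ ∀ f : H, c * ‖f‖ ^ 2 ≤ (⟪f, S f⟫_ℂ).re := by
  rcases subsingleton_or_nontrivial H with _ | _
  · exact ⟨1, one_pos, fun f ↦ by simp [Subsingleton.elim f 0]⟩
  obtain ⟨c, hc, hcS⟩ := (CFC.exists_pos_algebraMap_le_iff hS.nonneg.isSelfAdjoint).2
    fun x hx ↦ hS.spectrum_pos hx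
  refine ⟨c, hc, fun f ↦ ?_⟩
  have h := ((ContinuousLinearMap.le_def _ _).1 hcS).re_inner_nonneg_right f
  simpa [Algebra.algebraMap_eq_smul_one, inner_sub_right, inner_smul_right_eq_smul,
    ← Complex.ofReal_pow] using h

/-- Let `T` be a compact self-adjoint operator on a complex Hilbert space `H`
with `⟨f, f + Tf⟩ > 0` for all `f ≠ 0`. Then there is `λ > 0` with
`⟨f, f + Tf⟩ ≥ λ‖f‖²` and `‖f + Tf‖ ≥ λ‖f‖` for all `f`. -/
theorem compact_selfAdjoint_positive_lower_bound
    {H : Type*} [NormedAddCommGroup H] [InnerProductSpace ℂ H] [CompleteSpace H]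
    (T : H →L[ℂ] H) (hTc : IsCompactOperator T) (hTsa : IsSelfAdjoint T)
    (hpos : ∀ f : H, f ≠ 0 → 0 < (⟪f, f + T f⟫_ℂ).re) :
    ∃ lam : ℝ, 0 < lam ∧
      (∀ f : H, lam * ‖f‖ ^ 2 ≤ (⟪f, f + T f⟫_ℂ).re) ∧
      ∀ f : H, lam * ‖f‖ ≤ ‖f + T f‖ := by
  have hunit : IsUnit (1 + T) := by
    rcases hTc.hasEigenvalue_or_mem_resolventSet (neg_ne_zero.2 one_ne_zero : (-1 : ℂ) ≠ 0)
      with h | h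
    · obtain ⟨f, hf⟩ := h.exists_hasEigenvector
      have hTf : T f = -f := by simpa using hf.apply_eq_smul
      simpa [hTf] using hpos f hf.2
    · rw [spectrum.mem_resolventSet_iff, ← IsUnit.neg_iff] at h
      simpa [add_comm] using h
  have hnonneg : 0 ≤ 1 + T := by
    rw [ContinuousLinearMap.nonneg_iff_isPositive, ContinuousLinearMap.isPositive_def']
    refine ⟨(IsSelfAdjoint.one _).add hTsa, fun f ↦ ?_⟩
    rw [ContinuousLinearMap.reApplyInnerSelf_apply, inner_re_symm]
    rcases eq_or_ne f 0 with rfl | hf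
    · simp
    · exact (hpos f hf).le
  obtain ⟨c, hc, hbound⟩ :=
    (hunit.isStrictlyPositive hnonneg).exists_pos_mul_norm_sq_le_re_inner
  refine ⟨c, hc, hbound, fun f ↦ ?_⟩
  rcases eq_or_ne f 0 with rfl | hf
  · simp
  have h : c * ‖f‖ ^ 2 ≤ ‖f‖ * ‖f + T f‖ := (hbound f).trans (re_inner_le_norm (𝕜 := ℂ) f (f + T f))
  refine le_of_mul_le_mul_left ?_ (norm_pos_iff.2 hf)
  linarith
end

section
/- Let N > 0 and φ ∈ L¹(−2N, 2N). For x ∈ (0, N], let K^x_φ be the bounded operator on C([−1, 1]) defined by (K^x_φ q)(t) = ∫_{−1}^{1} x·φ(x(t−s)) q(s) ds. Then the map x ↦ K^x_φ from (0, N] to the Banach space of bounded operators on C([−1, 1]) (with the operator norm) is continuous, and moreover ‖K^x_φ‖ → 0 as x → 0⁺. -/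
open MeasureTheory

/-- A convolution operator on `C([-1, 1])` with integrable kernel `k` has operator norm at most the
`L¹` norm of `k` on `[-2, 2]`. -/
lemma norm_le_integral_norm_of_convolution {k : ℝ → ℂ} (hk : Integrable k)
    (T : C(Set.Icc (-1 : ℝ) 1, ℂ) →L[ℂ] C(Set.Icc (-1 : ℝ) 1, ℂ))
    (hT : ∀ (q : C(Set.Icc (-1 : ℝ) 1, ℂ)) (t : Set.Icc (-1 : ℝ) 1),
      T q t = ∫ s : Set.Icc (-1 : ℝ) 1, k (t.1 - s.1) * q s
        ∂((volume : Measure ℝ).comap Subtype.val)) :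
    ‖T‖ ≤ ∫ u in (-2 : ℝ)..2, ‖k u‖ := by
  have hnonneg : 0 ≤ ∫ u in (-2 : ℝ)..2, ‖k u‖ :=
    intervalIntegral.integral_nonneg (by norm_num) fun _ _ => norm_nonneg _
  refine T.opNorm_le_bound hnonneg fun q => ?_
  refine (ContinuousMap.norm_le _ (by positivity)).2 fun t => ?_
  obtain ⟨ht₁, ht₂⟩ := t.2
  have hint : Integrable (fun s : Set.Icc (-1 : ℝ) 1 => ‖k (t.1 - s.1)‖ * ‖q‖)
      ((volume : Measure ℝ).comap Subtype.val) :=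
    (((integrableOn_iff_comap_subtypeVal measurableSet_Icc).1
      (hk.comp_sub_left t.1).integrableOn).norm).mul_const _
  calc ‖T q t‖
      ≤ ∫ s : Set.Icc (-1 : ℝ) 1, ‖k (t.1 - s.1)‖ * ‖q‖
          ∂((volume : Measure ℝ).comap Subtype.val) := by
        rw [hT]
        refine norm_integral_le_of_norm_le hint (Filter.Eventually.of_forall fun s => ?_)
        rw [norm_mul]
        gcongr
        exact q.norm_coe_le_norm s
    _ = (∫ u in (t.1 - 1)..(t.1 + 1), ‖k u‖) * ‖q‖ := by
        rw [integral_mul_const, integral_subtype_comap measurableSet_Icc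
          (fun s : ℝ => ‖k (t.1 - s)‖), integral_Icc_eq_integral_Ioc,
          ← intervalIntegral.integral_of_le (by norm_num),
          intervalIntegral.integral_comp_sub_left (fun u => ‖k u‖), sub_neg_eq_add]
    _ ≤ (∫ u in (-2 : ℝ)..2, ‖k u‖) * ‖q‖ := by
        gcongr
        exact intervalIntegral.integral_mono_interval (by linarith) (by linarith) (by linarith)
          (Filter.Eventually.of_forall fun _ => norm_nonneg _) hk.norm.intervalIntegrable

/-- The `L¹`-normalised dilations `ψ ↦ y * ψ (y * ·)` are isometric on `L¹(ℝ)`. -/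
lemma integral_norm_dilation (ψ : ℝ → ℂ) {y : ℝ} (hy : 0 < y) :
    ∫ u, ‖(y : ℂ) * ψ (y * u)‖ = ∫ u, ‖ψ u‖ := by
  simp_rw [norm_mul, Complex.norm_of_nonneg hy.le]
  rw [integral_const_mul, Measure.integral_comp_mul_left (fun u => ‖ψ u‖),
    abs_of_pos (by positivity), smul_eq_mul, mul_inv_cancel_left₀ hy.ne']

lemma integrable_dilation {ψ : ℝ → ℂ} (hψ : Integrable ψ) {y : ℝ} (hy : 0 < y) :
    Integrable fun u => (y : ℂ) * ψ (y * u) :=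
  (hψ.comp_mul_left' hy.ne').const_mul _

/-- Dilations of a continuous compactly supported function depend continuously in `L¹(ℝ)` on the
dilation parameter. -/
lemma tendsto_integral_norm_dilation_sub_of_hasCompactSupport {g : ℝ → ℂ} (hg : Continuous g)
    (hgs : HasCompactSupport g) {x : ℝ} (hx : 0 < x) :
    Filter.Tendsto (fun y : ℝ => ∫ u, ‖(y : ℂ) * g (y * u) - (x : ℂ) * g (x * u)‖)
      (nhds x) (nhds 0) := by
  obtain ⟨R, hR⟩ := hgs.isCompact.isBounded.subset_closedBall 0
  have hzero : ∀ v : ℝ, R < |v| → g v = 0 := fun v hv => by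
    by_contra h
    have := hR (subset_tsupport g h)
    rw [mem_closedBall_zero_iff, Real.norm_eq_abs] at this
    linarith
  have hcont : ContinuousOn
      (fun y : ℝ => ∫ u, ‖(y : ℂ) * g (y * u) - (x : ℂ) * g (x * u)‖) (Set.Ioi (x / 2)) := by
    refine continuousOn_integral_of_compact_support
      (isCompact_closedBall (0 : ℝ) (R / (x / 2))) (by fun_prop) fun y u hy hu => ?_
    rw [mem_closedBall_zero_iff, Real.norm_eq_abs, not_le, div_lt_iff₀ (by positivity)] at hu
    have hlarge : ∀ z : ℝ, x / 2 ≤ z → g (z * u) = 0 := fun z hz => hzero _ <| by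
      rw [abs_mul, abs_of_pos (by linarith : 0 < z), mul_comm]
      exact hu.trans_le (by gcongr)
    rw [hlarge y (le_of_lt hy), hlarge x (by linarith)]
    simp
  simpa using (hcont.continuousAt (Ioi_mem_nhds (half_lt_self hx))).tendsto

/-- Dilations of an integrable function depend continuously in `L¹(ℝ)` on the dilation
parameter. -/
lemma tendsto_integral_norm_dilation_sub {ψ : ℝ → ℂ} (hψ : Integrable ψ) {x : ℝ} (hx : 0 < x) :
    Filter.Tendsto (fun y : ℝ => ∫ u, ‖(y : ℂ) * ψ (y * u) - (x : ℂ) * ψ (x * u)‖)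
      (nhds x) (nhds 0) := by
  rw [Metric.tendsto_nhds]
  intro ε hε
  obtain ⟨g, hgs, hψg, hg, hgi⟩ :=
    hψ.exists_hasCompactSupport_integral_sub_le (by positivity : 0 < ε / 3)
  filter_upwards [(tendsto_integral_norm_dilation_sub_of_hasCompactSupport hg hgs
    hx).eventually_lt_const (by positivity : 0 < ε / 3), Ioi_mem_nhds hx] with y hyg hy
  rw [Real.dist_0_eq_abs, abs_of_nonneg (integral_nonneg fun _ => norm_nonneg _)]
  have hdiff : Integrable (ψ - g) := hψ.sub hgi
  have hIy := (integrable_dilation hdiff hy).norm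
  have hIx := (integrable_dilation hdiff hx).norm
  have hIg : Integrable fun u => ‖(y : ℂ) * g (y * u) - (x : ℂ) * g (x * u)‖ :=
    ((integrable_dilation hgi hy).sub (integrable_dilation hgi hx)).norm
  calc ∫ u, ‖(y : ℂ) * ψ (y * u) - (x : ℂ) * ψ (x * u)‖
      ≤ ∫ u, (‖(y : ℂ) * (ψ - g) (y * u)‖ + ‖(x : ℂ) * (ψ - g) (x * u)‖
          + ‖(y : ℂ) * g (y * u) - (x : ℂ) * g (x * u)‖) := by
        refine integral_mono ((integrable_dilation hψ hy).sub (integrable_dilation hψ hx)).norm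
          ((hIy.add hIx).add hIg) fun u => ?_
        refine le_trans (le_of_eq ?_) ((norm_add_le _ _).trans
          (add_le_add_left (norm_sub_le _ _) _))
        simp only [Pi.sub_apply]
        congr 1
        ring
    _ = (∫ u, ‖(ψ - g) u‖) + (∫ u, ‖(ψ - g) u‖)
          + ∫ u, ‖(y : ℂ) * g (y * u) - (x : ℂ) * g (x * u)‖ := by
        rw [integral_add (by exact hIy.add hIx) hIg, integral_add hIy hIx, integral_norm_dilation _ hy,
          integral_norm_dilation _ hx]
    _ < ε := by
        simp only [Pi.sub_apply]
        linarith

/-- For `φ ∈ L¹(−2N, 2N)`, let `K^x_φ` (for `x ∈ (0, N]`) be the bounded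
operator on `C([−1,1])` given by `(K^x_φ q)(t) = ∫_{−1}^1 x·φ(x(t−s)) q(s) ds`. Then
`x ↦ K^x_φ` is continuous from `(0, N]` to bounded operators (operator norm), and
`‖K^x_φ‖ → 0` as `x → 0⁺`. -/
theorem conv_operator_family_continuous (N : ℝ) (hN : 0 < N) (φ : ℝ → ℂ)
    (hφ : IntegrableOn φ (Set.Ioo (-(2 * N)) (2 * N)))
    (K : ℝ → C(Set.Icc (-1 : ℝ) 1, ℂ) →L[ℂ] C(Set.Icc (-1 : ℝ) 1, ℂ))
    (hK : ∀ x ∈ Set.Ioc (0 : ℝ) N, ∀ q : C(Set.Icc (-1 : ℝ) 1, ℂ),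
      ∀ t : Set.Icc (-1 : ℝ) 1,
        K x q t = ∫ s : Set.Icc (-1 : ℝ) 1, (x : ℂ) * φ (x * (t.1 - s.1)) * q s
          ∂((volume : Measure ℝ).comap Subtype.val)) :
    ContinuousOn K (Set.Ioc 0 N) ∧
      Filter.Tendsto (fun x => ‖K x‖) (nhdsWithin 0 (Set.Ioi 0)) (nhds 0) := by
  set ψ : ℝ → ℂ := (Set.Icc (-(2 * N)) (2 * N)).indicator φ with hψdef
  have hψ : Integrable ψ :=
    (integrable_indicator_iff measurableSet_Icc).2 (by rwa [integrableOn_Icc_iff_integrableOn_Ioo])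
  have hKψ : ∀ x ∈ Set.Ioc (0 : ℝ) N, ∀ (q : C(Set.Icc (-1 : ℝ) 1, ℂ)) (t : Set.Icc (-1 : ℝ) 1),
      K x q t = ∫ s : Set.Icc (-1 : ℝ) 1, (x : ℂ) * ψ (x * (t.1 - s.1)) * q s
        ∂((volume : Measure ℝ).comap Subtype.val) := by
    intro x hx q t
    rw [hK x hx q t]
    congr with s
    obtain ⟨hx₀, hxN⟩ := hx
    obtain ⟨ht₁, ht₂⟩ := t.2
    obtain ⟨hs₁, hs₂⟩ := s.2
    rw [hψdef, Set.indicator_of_mem]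
    constructor <;> nlinarith
  constructor
  · intro x hx
    refine (tendsto_iff_norm_sub_tendsto_zero
      (E := C(Set.Icc (-1 : ℝ) 1, ℂ) →L[ℂ] C(Set.Icc (-1 : ℝ) 1, ℂ))).2 ?_
    refine squeeze_zero' (Filter.Eventually.of_forall fun y => (K y - K x).opNorm_nonneg) ?_
      ((tendsto_integral_norm_dilation_sub hψ hx.1).mono_left nhdsWithin_le_nhds)
    filter_upwards [self_mem_nhdsWithin] with y hy
    have hk := (integrable_dilation hψ hy.1).sub (integrable_dilation hψ hx.1)
    refine (norm_le_integral_norm_of_convolution hk (K y - K x) fun q t => ?_).trans ?_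
    · have hint : ∀ z ∈ Set.Ioc (0 : ℝ) N,
          Integrable (fun s : Set.Icc (-1 : ℝ) 1 => (z : ℂ) * ψ (z * (t.1 - s.1)) * q s)
            ((volume : Measure ℝ).comap Subtype.val) := fun z hz =>
        ((integrableOn_iff_comap_subtypeVal measurableSet_Icc).1
          ((integrable_dilation hψ hz.1).comp_sub_left t.1).integrableOn).mul_bdd (c := ‖q‖)
          q.continuous.aestronglyMeasurable
          (Filter.Eventually.of_forall fun s => q.norm_coe_le_norm s)
      rw [sub_apply, ContinuousMap.sub_apply, hKψ y hy, hKψ x hx,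
        ← integral_sub (hint y hy) (hint x hx)]
      simp only [Pi.sub_apply, sub_mul]
    · rw [intervalIntegral.integral_of_le (by norm_num)]
      exact setIntegral_le_integral hk.norm (Filter.Eventually.of_forall fun _ => norm_nonneg _)
  · have hprim : Continuous fun b : ℝ => ∫ u in (0 : ℝ)..b, ‖ψ u‖ :=
      hψ.norm.continuous_primitive 0
    have hlim : Filter.Tendsto
        (fun x : ℝ => (∫ u in (0 : ℝ)..x * 2, ‖ψ u‖) - ∫ u in (0 : ℝ)..x * (-2), ‖ψ u‖)
        (nhdsWithin 0 (Set.Ioi 0)) (nhds 0) := by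
      have : Continuous fun x : ℝ =>
          (∫ u in (0 : ℝ)..x * 2, ‖ψ u‖) - ∫ u in (0 : ℝ)..x * (-2), ‖ψ u‖ :=
        (hprim.comp (continuous_mul_const 2)).sub (hprim.comp (continuous_mul_const (-2)))
      simpa using (this.tendsto 0).mono_left nhdsWithin_le_nhds
    refine squeeze_zero' (Filter.Eventually.of_forall fun x => (K x).opNorm_nonneg) ?_ hlim
    filter_upwards [Ioc_mem_nhdsGT hN] with x hx
    refine (norm_le_integral_norm_of_convolution (integrable_dilation hψ hx.1) (K x)
      (hKψ x hx)).trans (le_of_eq ?_)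
    simp_rw [norm_mul, Complex.norm_of_nonneg hx.1.le]
    rw [intervalIntegral.integral_const_mul,
      intervalIntegral.mul_integral_comp_mul_left (f := fun u => ‖ψ u‖),
      intervalIntegral.integral_interval_sub_left hψ.norm.intervalIntegrable
        hψ.norm.intervalIntegrable]
end
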